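/- Linearization of the Hamilton–Jacobi plus continuity system into a second-order linear wave equation (De Martini–Santamato): let n ≥ 1, U ⊆ ℝⁿ open nonempty, g a metric on U, A = (A_μ), S : U → ℝ smooth real functions, ρ : U → ℝ smooth with ρ > 0, c₀ : U → ℝ smooth, ħ > 0 and κ ∈ ℝ constants; set k_μ = ∂_μ S − κ A_μ and ψ = √ρ · e^{iS/ħ}. Then ψ satisfies the linear second-order equation (1/√|det g|) · ( (ħ/i) ∂_μ − κ A_μ ) [ √|det g| g^{μν} ( (ħ/i) ∂_ν − κ A_ν ) ψ ] = c₀ ψ on U if and only if both the Hamilton–Jacobi equation g^{μν} k_μ k_ν = c₀ + ħ² (Δ_g √ρ)/√ρ and the continuity equation ∂_μ ( √|det g| ρ g^{μν} k_ν ) = 0 hold on U. Thus the nonlinear Hamilton–Jacobi dynamics with quantum potential term is equivalent to a linear eigenvalue-type equation for the wave function ψ. -/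

import Mathlib

noncomputable section

open scoped BigOperators

/-- Partial derivative `∂_μ f` of a real-valued function on `ℝⁿ`. -/
def pd {n : ℕ} (μ : Fin n) (f : (Fin n → ℝ) → ℝ) : (Fin n → ℝ) → ℝ :=
  fun x => fderiv ℝ f x (Pi.single μ 1)

/-- Partial derivative `∂_μ f` of a complex-valued function on `ℝⁿ`. -/
def pdC {n : ℕ} (μ : Fin n) (f : (Fin n → ℝ) → ℂ) : (Fin n → ℝ) → ℂ :=
  fun x => fderiv ℝ f x (Pi.single μ 1)

/-- Christoffel symbols `_gΓ^μ_{νλ}` of the metric `g` (with inverse `ginv`). -/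
def christoffel {n : ℕ} (g ginv : (Fin n → ℝ) → Fin n → Fin n → ℝ)
    (μ ν lam : Fin n) (x : Fin n → ℝ) : ℝ :=
  (1/2) * ∑ κ, ginv x μ κ *
    (pd ν (fun y => g y κ lam) x + pd lam (fun y => g y κ ν) x - pd κ (fun y => g y ν lam) x)

/-- Weylian affine connection `Γ^μ_{νλ}` of the Weylian metric `(g, φ)`:
`Γ^μ_{νλ} = _gΓ^μ_{νλ} + δ^μ_ν φ_λ + δ^μ_λ φ_ν − g_{νλ} φ^μ`. -/
def weylConn {n : ℕ} (g ginv : (Fin n → ℝ) → Fin n → Fin n → ℝ)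
    (φ : (Fin n → ℝ) → Fin n → ℝ) (μ ν lam : Fin n) (x : Fin n → ℝ) : ℝ :=
  christoffel g ginv μ ν lam x
    + (if ν = μ then φ x lam else 0) + (if lam = μ then φ x ν else 0)
    - g x ν lam * ∑ κ, ginv x μ κ * φ x κ

/-- Curvature tensor `R^μ_{νλκ}` of a family of connection coefficients `Γ`. -/
def curvOf {n : ℕ} (Γ : (Fin n → ℝ) → Fin n → Fin n → Fin n → ℝ)
    (μ ν lam κ : Fin n) (x : Fin n → ℝ) : ℝ :=
  pd lam (fun y => Γ y μ ν κ) x - pd κ (fun y => Γ y μ ν lam) x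
    + ∑ σ, Γ x μ lam σ * Γ x σ ν κ - ∑ σ, Γ x μ κ σ * Γ x σ ν lam

/-- Ricci tensor `R_{νκ} = R^μ_{νμκ}`. -/
def ricciOf {n : ℕ} (Γ : (Fin n → ℝ) → Fin n → Fin n → Fin n → ℝ)
    (ν κ : Fin n) (x : Fin n → ℝ) : ℝ :=
  ∑ μ, curvOf Γ μ ν μ κ x

/-- Scalar curvature `R = g^{νκ} R_{νκ}`. -/
def scalarOf {n : ℕ} (ginv : (Fin n → ℝ) → Fin n → Fin n → ℝ)
    (Γ : (Fin n → ℝ) → Fin n → Fin n → Fin n → ℝ) (x : Fin n → ℝ) : ℝ :=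
  ∑ ν, ∑ κ, ginv x ν κ * ricciOf Γ ν κ x

/-- Volume factor `√|det g|`. -/
def volFac {n : ℕ} (g : (Fin n → ℝ) → Fin n → Fin n → ℝ) (x : Fin n → ℝ) : ℝ :=
  Real.sqrt |Matrix.det (Matrix.of (g x))|

/-- Laplace–Beltrami operator `Δ_g f = (1/√|det g|) ∂_μ ( √|det g| g^{μν} ∂_ν f )`. -/
def laplaceBeltrami {n : ℕ} (g ginv : (Fin n → ℝ) → Fin n → Fin n → ℝ)
    (f : (Fin n → ℝ) → ℝ) (x : Fin n → ℝ) : ℝ :=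
  (volFac g x)⁻¹ * ∑ μ, pd μ (fun y => volFac g y * ∑ ν, ginv y μ ν * pd ν f y) x

/-- Minkowski matrix `η = diag(1, −1, −1, −1)`. -/
def etaM : Fin 4 → Fin 4 → ℝ :=
  fun μ ν => if μ = ν then (if μ = 0 then 1 else -1) else 0

theorem pdC_polar {n : ℕ} {a b S : (Fin n → ℝ) → ℝ} {x : Fin n → ℝ} (hbar : ℝ)
    (ha : DifferentiableAt ℝ a x) (hb : DifferentiableAt ℝ b x) (hS : DifferentiableAt ℝ S x)
    (μ : Fin n) :
    pdC μ (fun y => ((hbar : ℂ) / Complex.I * (a y : ℂ) + (b y : ℂ)) *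
        Complex.exp (Complex.I * (S y : ℂ) / (hbar : ℂ))) x =
      ((hbar : ℂ) / Complex.I * (pd μ a x : ℂ) + (pd μ b x : ℂ) +
        ((hbar : ℂ) / Complex.I * (a x : ℂ) + (b x : ℂ)) *
          (Complex.I / (hbar : ℂ) * (pd μ S x : ℂ))) *
        Complex.exp (Complex.I * (S x : ℂ) / (hbar : ℂ)) := by
  have ofReal {f : (Fin n → ℝ) → ℝ} (hf : DifferentiableAt ℝ f x) :
      HasFDerivAt (fun y => (f y : ℂ)) (Complex.ofRealCLM.comp (fderiv ℝ f x)) x :=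
    Complex.ofRealCLM.hasFDerivAt.comp x hf.hasFDerivAt
  have hE := ((ofReal hS).const_mul (Complex.I / (hbar : ℂ))).cexp
  have h := (((ofReal ha).const_mul ((hbar : ℂ) / Complex.I)).add (ofReal hb)).mul hE
  simp only [mul_div_right_comm]
  simp only [pdC, pd]
  erw [h.fderiv]
  simp
  ring

theorem pd_mul {n : ℕ} {a b : (Fin n → ℝ) → ℝ} {x : Fin n → ℝ}
    (ha : DifferentiableAt ℝ a x) (hb : DifferentiableAt ℝ b x) (μ : Fin n) :
    pd μ (fun y => a y * b y) x = a x * pd μ b x + pd μ a x * b x := by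
  simp only [pd]
  rw [fderiv_fun_mul ha hb]
  simp [mul_comm]

theorem pd_congr {n : ℕ} {a b : (Fin n → ℝ) → ℝ} {U : Set (Fin n → ℝ)} (hU : IsOpen U)
    {x : Fin n → ℝ} (hx : x ∈ U) (h : ∀ y ∈ U, a y = b y) (μ : Fin n) :
    pd μ a x = pd μ b x := by
  simp only [pd]
  rw [Filter.EventuallyEq.fderiv_eq (Filter.eventuallyEq_of_mem (hU.mem_nhds hx) h)]

theorem pdC_congr {n : ℕ} {a b : (Fin n → ℝ) → ℂ} {U : Set (Fin n → ℝ)} (hU : IsOpen U)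
    {x : Fin n → ℝ} (hx : x ∈ U) (h : ∀ y ∈ U, a y = b y) (μ : Fin n) :
    pdC μ a x = pdC μ b x := by
  simp only [pdC]
  rw [Filter.EventuallyEq.fderiv_eq (Filter.eventuallyEq_of_mem (hU.mem_nhds hx) h)]

theorem differentiableAt_pd {n : ℕ} {f : (Fin n → ℝ) → ℝ} {U : Set (Fin n → ℝ)} (hU : IsOpen U)
    (hf : ContDiffOn ℝ (⊤ : ℕ∞) f U) {x : Fin n → ℝ} (hx : x ∈ U) (μ : Fin n) :
    DifferentiableAt ℝ (pd μ f) x := by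
  have h : ContDiffOn ℝ (⊤ : ℕ∞) (fderiv ℝ f) U :=
    hf.fderiv_of_isOpen hU le_rfl
  exact ((h.differentiableOn (by simp)).differentiableAt (hU.mem_nhds hx)).clm_apply
    (differentiableAt_const _)

theorem matrix_of_mul_of_eq_one {n : ℕ} {a b : Fin n → Fin n → ℝ}
    (h : ∀ μ ν, ∑ σ, a μ σ * b σ ν = if μ = ν then (1 : ℝ) else 0) :
    Matrix.of a * Matrix.of b = 1 := by
  ext μ ν
  simp [Matrix.mul_apply, Matrix.one_apply, h]

theorem inverse_metric_symm {n : ℕ} {a b : Fin n → Fin n → ℝ} (ha : ∀ μ ν, a μ ν = a ν μ)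
    (h : ∀ μ ν, ∑ σ, a μ σ * b σ ν = if μ = ν then (1 : ℝ) else 0) (μ ν : Fin n) :
    b μ ν = b ν μ := by
  have hab := matrix_of_mul_of_eq_one h
  have hsymm : (Matrix.of a).IsSymm := Matrix.IsSymm.ext fun i j => ha j i
  have hb : (Matrix.of a)⁻¹ = Matrix.of b := Matrix.inv_eq_right_inv hab
  have hbs : (Matrix.of b).IsSymm := hb ▸ hsymm.inv
  exact hbs.apply ν μ

theorem det_metric_ne_zero {n : ℕ} {a b : Fin n → Fin n → ℝ}
    (h : ∀ μ ν, ∑ σ, a μ σ * b σ ν = if μ = ν then (1 : ℝ) else 0) :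
    (Matrix.of a).det ≠ 0 := by
  have hdet := congrArg Matrix.det (matrix_of_mul_of_eq_one h)
  rw [Matrix.det_mul, Matrix.det_one] at hdet
  exact left_ne_zero_of_mul_eq_one hdet

theorem differentiableAt_volFac {n : ℕ} {g : (Fin n → ℝ) → Fin n → Fin n → ℝ} {x : Fin n → ℝ}
    (hg : ∀ μ ν, DifferentiableAt ℝ (fun y => g y μ ν) x) (hdet : (Matrix.of (g x)).det ≠ 0) :
    DifferentiableAt ℝ (volFac g) x := by
  have hd : DifferentiableAt ℝ (fun y => (Matrix.of (g y)).det) x := by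
    simp only [Matrix.det_apply, Matrix.of_apply]
    fun_prop
  exact (hd.abs hdet).sqrt (abs_ne_zero.mpr hdet)

/-- The twice-applied covariant momentum operator on `R e^{iS/ħ}`, divided by the phase: its real
part is the Hamilton–Jacobi expression and its imaginary part the continuity expression. -/
theorem wave_operator_polar {n : ℕ} {U : Set (Fin n → ℝ)} (hU : IsOpen U)
    {ginv : (Fin n → ℝ) → Fin n → Fin n → ℝ} {A k : (Fin n → ℝ) → Fin n → ℝ}
    {v R S : (Fin n → ℝ) → ℝ} {hbar κ : ℝ} (hhbar : hbar ≠ 0)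
    (hginv : ∀ x ∈ U, ∀ μ ν, DifferentiableAt ℝ (fun y => ginv y μ ν) x)
    (hsym : ∀ x ∈ U, ∀ μ ν, ginv x μ ν = ginv x ν μ)
    (hv : ∀ x ∈ U, DifferentiableAt ℝ v x)
    (hR : ContDiffOn ℝ (⊤ : ℕ∞) R U) (hS : ContDiffOn ℝ (⊤ : ℕ∞) S U)
    (hkd : ∀ x ∈ U, ∀ μ, DifferentiableAt ℝ (fun y => k y μ) x)
    (hk : ∀ y μ, k y μ = pd μ S y - κ * A y μ)
    {ψ : (Fin n → ℝ) → ℂ}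
    (hψ : ∀ y, ψ y = (R y : ℂ) * Complex.exp (Complex.I * (S y : ℂ) / (hbar : ℂ)))
    {F : (Fin n → ℝ) → Fin n → ℂ}
    (hF : ∀ y μ, F y μ = (v y : ℂ) *
        ∑ ν, (ginv y μ ν : ℂ) *
          (((hbar : ℂ) / Complex.I) * pdC ν ψ y - (κ : ℂ) * (A y ν : ℂ) * ψ y))
    {x : Fin n → ℝ} (hx : x ∈ U) :
    (R x : ℂ) * ∑ μ, (((hbar : ℂ) / Complex.I) * pdC μ (fun y => F y μ) x
        - (κ : ℂ) * (A x μ : ℂ) * F x μ) =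
      (((R x * (v x * R x * (∑ μ, ∑ ν, ginv x μ ν * k x μ * k x ν) -
          hbar ^ 2 * ∑ μ, pd μ (fun y => v y * ∑ ν, ginv y μ ν * pd ν R y) x) : ℝ) : ℂ) +
        (hbar : ℂ) / Complex.I *
          ((∑ μ, pd μ (fun y => v y * R y ^ 2 * ∑ ν, ginv y μ ν * k y ν) x : ℝ) : ℂ)) *
        Complex.exp (Complex.I * (S x : ℂ) / (hbar : ℂ)) := by
  have hh : (hbar : ℂ) ≠ 0 := by exact_mod_cast hhbar
  have hRd : ∀ y ∈ U, DifferentiableAt ℝ R y := fun y hy =>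
    (hR.differentiableOn (by simp)).differentiableAt (hU.mem_nhds hy)
  have hSd : ∀ y ∈ U, DifferentiableAt ℝ S y := fun y hy =>
    (hS.differentiableOn (by simp)).differentiableAt (hU.mem_nhds hy)
  have hpsi : ∀ y ∈ U, ∀ ν, (hbar : ℂ) / Complex.I * pdC ν ψ y - (κ : ℂ) * (A y ν : ℂ) * ψ y =
      ((hbar : ℂ) / Complex.I * (pd ν R y : ℂ) + ((R y * k y ν : ℝ) : ℂ)) *
        Complex.exp (Complex.I * (S y : ℂ) / (hbar : ℂ)) := by
    intro y hy ν
    have h := pdC_polar hbar (differentiableAt_const (0 : ℝ)) (hRd y hy) (hSd y hy) ν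
    have h0 : pd ν (fun _ => (0 : ℝ)) y = 0 := by simp [pd]
    rw [h0] at h
    simp only [Complex.ofReal_zero, mul_zero, zero_add] at h
    rw [show ψ = _ from funext hψ, h, hk]
    push_cast
    field_simp
    ring
  set D : Fin n → (Fin n → ℝ) → ℝ := fun μ y => ∑ ν, ginv y μ ν * pd ν R y with hD
  set P : Fin n → (Fin n → ℝ) → ℝ := fun μ y => ∑ ν, ginv y μ ν * k y ν with hP
  have hFU : ∀ μ, ∀ y ∈ U, F y μ =
      ((hbar : ℂ) / Complex.I * ((v y * D μ y : ℝ) : ℂ) + ((v y * (R y * P μ y) : ℝ) : ℂ)) *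
        Complex.exp (Complex.I * (S y : ℂ) / (hbar : ℂ)) := by
    intro μ y hy
    rw [hF, Finset.sum_congr rfl fun ν _ => by rw [hpsi y hy ν]]
    simp only [hD, hP]
    push_cast
    simp only [Finset.mul_sum, Finset.sum_mul, ← Finset.sum_add_distrib]
    refine Finset.sum_congr rfl fun ν _ => ?_
    ring
  have hDd : ∀ μ, DifferentiableAt ℝ (D μ) x := fun μ =>
    DifferentiableAt.fun_sum fun ν _ => (hginv x hx μ ν).mul (differentiableAt_pd hU hR hx ν)
  have hPd : ∀ μ, DifferentiableAt ℝ (P μ) x := fun μ =>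
    DifferentiableAt.fun_sum fun ν _ => (hginv x hx μ ν).mul (hkd x hx ν)
  have hvx := hv x hx
  have hRx := hRd x hx
  have hterm : ∀ μ, (hbar : ℂ) / Complex.I * pdC μ (fun y => F y μ) x
        - (κ : ℂ) * (A x μ : ℂ) * F x μ =
      (((v x * R x * (k x μ * P μ x) - hbar ^ 2 * pd μ (fun y => v y * D μ y) x : ℝ) : ℂ) +
        (hbar : ℂ) / Complex.I *
          ((pd μ (fun y => v y * (R y * P μ y)) x + v x * (k x μ * D μ x) : ℝ) : ℂ)) *
        Complex.exp (Complex.I * (S x : ℂ) / (hbar : ℂ)) := by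
    intro μ
    rw [pdC_congr hU hx (hFU μ), hFU μ x hx,
      pdC_polar hbar (hvx.fun_mul (hDd μ)) (hvx.fun_mul (hRx.fun_mul (hPd μ))) (hSd x hx), hk]
    push_cast
    field_simp
    linear_combination
      (hbar : ℂ) ^ 2 * (pd μ (fun y => v y * D μ y) x : ℂ) * Complex.I_sq
  have hcont : ∀ μ, pd μ (fun y => v y * R y ^ 2 * P μ y) x =
      R x * (pd μ (fun y => v y * (R y * P μ y)) x + v x * (P μ x * pd μ R x)) := by
    intro μ
    rw [show (fun y => v y * R y ^ 2 * P μ y) = fun y => R y * (v y * (R y * P μ y)) by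
      funext y; ring, pd_mul hRx (hvx.fun_mul (hRx.fun_mul (hPd μ)))]
    ring
  have hPR : ∑ μ, P μ x * pd μ R x = ∑ μ, k x μ * D μ x := by
    simp only [hD, hP, Finset.sum_mul, Finset.mul_sum]
    rw [Finset.sum_comm]
    refine Finset.sum_congr rfl fun μ _ => Finset.sum_congr rfl fun ν _ => ?_
    rw [hsym x hx ν μ]
    ring
  have hkk : ∑ μ, ∑ ν, ginv x μ ν * k x μ * k x ν = ∑ μ, k x μ * P μ x := by
    simp only [hP, Finset.mul_sum]
    refine Finset.sum_congr rfl fun μ _ => Finset.sum_congr rfl fun ν _ => ?_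
    ring
  rw [Finset.sum_congr rfl fun μ _ => hterm μ, ← Finset.sum_mul, Finset.sum_add_distrib,
    ← Finset.mul_sum, ← Complex.ofReal_sum, ← Complex.ofReal_sum, hkk,
    Finset.sum_congr rfl fun μ _ => hcont μ]
  simp only [← Finset.mul_sum, Finset.sum_add_distrib, Finset.sum_sub_distrib]
  rw [hPR]
  push_cast
  ring

/-- Linearization of the Hamilton–Jacobi plus continuity system into a
second-order linear wave equation (De Martini–Santamato): with `k_μ = ∂_μ S − κ A_μ` and
`ψ = √ρ e^{iS/ħ}`, `ψ` satisfies
`(1/√|det g|) ((ħ/i)∂_μ − κA_μ)[ √|det g| g^{μν} ((ħ/i)∂_ν − κA_ν)ψ ] = c₀ ψ` on `U`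
iff both `g^{μν} k_μ k_ν = c₀ + ħ² (Δ_g √ρ)/√ρ` and `∂_μ( √|det g| ρ g^{μν} k_ν ) = 0`
hold on `U`. -/
theorem de_martini_santamato_linearization {n : ℕ} (hn : 1 ≤ n)
    (U : Set (Fin n → ℝ)) (hU : IsOpen U) (hUne : U.Nonempty)
    (g ginv : (Fin n → ℝ) → Fin n → Fin n → ℝ)
    (hg : ∀ μ ν, ContDiffOn ℝ (⊤ : ℕ∞) (fun x => g x μ ν) U)
    (hginv : ∀ μ ν, ContDiffOn ℝ (⊤ : ℕ∞) (fun x => ginv x μ ν) U)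
    (hsym : ∀ x ∈ U, ∀ μ ν, g x μ ν = g x ν μ)
    (hinv : ∀ x ∈ U, ∀ μ ν, ∑ σ, g x μ σ * ginv x σ ν = if μ = ν then (1:ℝ) else 0)
    (A : (Fin n → ℝ) → Fin n → ℝ) (hA : ∀ μ, ContDiffOn ℝ (⊤ : ℕ∞) (fun x => A x μ) U)
    (S : (Fin n → ℝ) → ℝ) (hS : ContDiffOn ℝ (⊤ : ℕ∞) S U)
    (ρ : (Fin n → ℝ) → ℝ) (hρ : ContDiffOn ℝ (⊤ : ℕ∞) ρ U) (hρpos : ∀ x ∈ U, 0 < ρ x)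
    (c₀ : (Fin n → ℝ) → ℝ) (hc₀ : ContDiffOn ℝ (⊤ : ℕ∞) c₀ U)
    (hbar κ : ℝ) (hhbar : 0 < hbar)
    (k : (Fin n → ℝ) → Fin n → ℝ)
    (hk : ∀ y μ, k y μ = pd μ S y - κ * A y μ)
    (ψ : (Fin n → ℝ) → ℂ)
    (hψ : ∀ y, ψ y = (Real.sqrt (ρ y) : ℂ) * Complex.exp (Complex.I * (S y : ℂ) / (hbar : ℂ)))
    (F : (Fin n → ℝ) → Fin n → ℂ)
    (hF : ∀ y μ, F y μ = (volFac g y : ℂ) *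
        ∑ ν, (ginv y μ ν : ℂ) *
          (((hbar : ℂ) / Complex.I) * pdC ν ψ y - (κ : ℂ) * (A y ν : ℂ) * ψ y)) :
    (∀ x ∈ U,
        ((volFac g x : ℂ))⁻¹ *
            (∑ μ, (((hbar : ℂ) / Complex.I) * pdC μ (fun y => F y μ) x
              - (κ : ℂ) * (A x μ : ℂ) * F x μ))
          = (c₀ x : ℂ) * ψ x)
    ↔ ((∀ x ∈ U,
          ∑ μ, ∑ ν, ginv x μ ν * k x μ * k x ν
            = c₀ x
              + hbar ^ 2 * laplaceBeltrami g ginv (fun y => Real.sqrt (ρ y)) x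
                  / Real.sqrt (ρ x))
      ∧ (∀ x ∈ U,
          ∑ μ, pd μ (fun y => volFac g y * ρ y * ∑ ν, ginv y μ ν * k y ν) x = 0)) := by
  have at_mem {f : (Fin n → ℝ) → ℝ} (hf : ContDiffOn ℝ (⊤ : ℕ∞) f U) :
      ∀ x ∈ U, DifferentiableAt ℝ f x := fun x hx =>
    (hf.differentiableOn (by simp)).differentiableAt (hU.mem_nhds hx)
  have hdet : ∀ x ∈ U, (Matrix.of (g x)).det ≠ 0 := fun x hx => det_metric_ne_zero (hinv x hx)
  have hR : ContDiffOn ℝ (⊤ : ℕ∞) (fun y => Real.sqrt (ρ y)) U :=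
    hρ.sqrt fun x hx => (hρpos x hx).ne'
  have hkd : ∀ x ∈ U, ∀ μ, DifferentiableAt ℝ (fun y => k y μ) x := by
    intro x hx μ
    simp only [hk]
    exact (differentiableAt_pd hU hS hx μ).sub ((at_mem (hA μ) x hx).const_mul κ)
  rw [← forall₂_and]
  refine forall₂_congr fun x hx => ?_
  have hv : 0 < volFac g x := Real.sqrt_pos.mpr (abs_pos.mpr (hdet x hx))
  have hRpos : 0 < Real.sqrt (ρ x) := Real.sqrt_pos.mpr (hρpos x hx)
  have hcont : ∑ μ, pd μ (fun y => volFac g y * ρ y * ∑ ν, ginv y μ ν * k y ν) x =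
      ∑ μ, pd μ (fun y => volFac g y * Real.sqrt (ρ y) ^ 2 * ∑ ν, ginv y μ ν * k y ν) x :=
    Finset.sum_congr rfl fun μ _ =>
      pd_congr hU hx (fun y hy => by rw [Real.sq_sqrt (hρpos y hy).le]) μ
  have hmain := wave_operator_polar hU hhbar.ne' (fun x hx μ ν => at_mem (hginv μ ν) x hx)
    (fun x hx => inverse_metric_symm (hsym x hx) (hinv x hx))
    (fun x hx => differentiableAt_volFac (fun μ ν => at_mem (hg μ ν) x hx) (hdet x hx))
    hR hS hkd hk hψ hF hx
  rw [hcont, hψ x, laplaceBeltrami]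
  generalize (∑ μ, (((hbar : ℂ) / Complex.I) * pdC μ (fun y => F y μ) x
    - (κ : ℂ) * (A x μ : ℂ) * F x μ)) = W at hmain ⊢
  generalize (∑ μ, pd μ (fun y => volFac g y * Real.sqrt (ρ y) ^ 2 *
    ∑ ν, ginv y μ ν * k y ν) x) = C at hmain ⊢
  generalize (∑ μ, pd μ (fun y => volFac g y *
    ∑ ν, ginv y μ ν * pd ν (fun y => Real.sqrt (ρ y)) y) x) = L at hmain ⊢
  generalize (∑ μ, ∑ ν, ginv x μ ν * k x μ * k x ν) = K at hmain ⊢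
  generalize Real.sqrt (ρ x) = R at hmain hRpos ⊢
  generalize volFac g x = v at hmain hv ⊢
  have hE := Complex.exp_ne_zero (Complex.I * (S x : ℂ) / (hbar : ℂ))
  generalize Complex.exp (Complex.I * (S x : ℂ) / (hbar : ℂ)) = E at hmain hE ⊢
  have hvC : (v : ℂ) ≠ 0 := by exact_mod_cast hv.ne'
  have hRC : (R : ℂ) ≠ 0 := by exact_mod_cast hRpos.ne'
  have hdiv : (hbar : ℂ) / Complex.I * (C : ℂ) = ((-(hbar * C) : ℝ) : ℂ) * Complex.I := by
    rw [Complex.div_I]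
    push_cast
    ring
  have hwave : (v : ℂ)⁻¹ * W = (c₀ x : ℂ) * ((R : ℂ) * E) ↔
      ((R * (v * R * K - hbar ^ 2 * L) : ℝ) : ℂ) + ((-(hbar * C) : ℝ) : ℂ) * Complex.I =
        ((v * R * (c₀ x * R) : ℝ) : ℂ) := by
    rw [← mul_right_inj' (mul_ne_zero hvC hRC),
      show (v : ℂ) * R * ((v : ℂ)⁻¹ * W) = R * W by field_simp, hmain, ← hdiv]
    nth_rewrite 2 [← mul_left_inj' hE]
    push_cast
    ring_nf
  rw [hwave, Complex.ext_iff]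
  simp only [Complex.add_re, Complex.add_im, Complex.re_ofReal_mul, Complex.im_ofReal_mul,
    Complex.ofReal_re, Complex.ofReal_im, Complex.I_re, Complex.I_im, mul_zero, mul_one,
    add_zero, zero_add, neg_eq_zero, mul_eq_zero, hhbar.ne', false_or]
  refine and_congr_left fun _ => ?_
  field_simp
  constructor <;> intro h <;> linarith
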